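/- arXiv:2601.18349 — 5 statements merged into one kernel-verified Lean document; each statement's English description precedes it below -/
import Mathlib

section
/- Let d ≥ k ≥ 1 be integers. If every exponential-polynomial instance of order at most d with k sequences is MSTV-reducible, then every exponential-polynomial instance of order at most d+1 with k+1 sequences is MSTV-reducible. -/
open scoped Classical

noncomputable section

/-- `ℚ̄`, a fixed algebraic closure of `ℚ`. -/
abbrev Qbar : Type := AlgebraicClosure ℚ

/-- An absolute value is non-Archimedean if it satisfies the ultrametric inequality. -/
def IsNonarch {L : Type*} [Field L] (v : AbsoluteValue L ℝ) : Prop :=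
  ∀ x y : L, v (x + y) ≤ max (v x) (v y)

/-- An absolute value is nontrivial if it takes a value `≠ 1` at some nonzero element. -/
def AbsNontrivial {L : Type*} [Field L] (v : AbsoluteValue L ℝ) : Prop :=
  ∃ x : L, x ≠ 0 ∧ v x ≠ 1

/-- An exponential-polynomial instance of order at most `d` with `k` sequences: distinct
nonzero roots `lam i` in `ℚ̄` whose ratios are not roots of unity, multiplicities `m i ≥ 1`
with `∑ m i ≤ d`, and `k` linearly independent coefficient vectors indexed by
`T = {(i, j) : j < m i}`. -/
structure ExpPolyInstance (d k : ℕ) where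
  s : ℕ
  lam : Fin s → Qbar
  m : Fin s → ℕ
  coeff : Fin k → ((i : Fin s) × Fin (m i)) → Qbar
  lam_ne_zero : ∀ i, lam i ≠ 0
  lam_injective : Function.Injective lam
  nondeg : ∀ i j, i ≠ j → ∀ n : ℕ, 1 ≤ n → (lam i / lam j) ^ n ≠ 1
  m_pos : ∀ i, 1 ≤ m i
  order_le : (∑ i, m i) ≤ d
  indep : LinearIndependent Qbar coeff

/-- A nonzero vector `w : T → ℚ̄` lies in the MSTV class (relative to the roots `lam`) if
there are a number field `L ⊆ ℚ̄` containing the roots and a nontrivial absolute value `v` on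
`L` such that among the indices `i` with some `w (i, j) ≠ 0`, the number of `v`-dominant ones
is at most `2` when `v` is non-Archimedean and at most `3` when `v` is Archimedean. -/
def InMSTV {s : ℕ} {m : Fin s → ℕ} (lam : Fin s → Qbar)
    (w : ((i : Fin s) × Fin (m i)) → Qbar) : Prop :=
  w ≠ 0 ∧
  ∃ (L : IntermediateField ℚ Qbar) (hmem : ∀ i, lam i ∈ L),
    FiniteDimensional ℚ L ∧
    ∃ v : AbsoluteValue L ℝ, AbsNontrivial v ∧
      (IsNonarch v →
        (Finset.univ.filter (fun i : Fin s =>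
          (∃ j, w ⟨i, j⟩ ≠ 0) ∧
          ∀ i' : Fin s, (∃ j', w ⟨i', j'⟩ ≠ 0) →
            v ⟨lam i', hmem i'⟩ ≤ v ⟨lam i, hmem i⟩)).card ≤ 2) ∧
      (¬ IsNonarch v →
        (Finset.univ.filter (fun i : Fin s =>
          (∃ j, w ⟨i, j⟩ ≠ 0) ∧
          ∀ i' : Fin s, (∃ j', w ⟨i', j'⟩ ≠ 0) →
            v ⟨lam i', hmem i'⟩ ≤ v ⟨lam i, hmem i⟩)).card ≤ 3)

/-- An instance is MSTV-reducible if some nonzero linear combination of its coefficient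
vectors lies in the MSTV class. -/
def MSTVReducible {d k : ℕ} (I : ExpPolyInstance d k) : Prop :=
  ∃ β : Fin k → Qbar, β ≠ 0 ∧ InMSTV I.lam (∑ p, β p • I.coeff p)

/-- In an algebraic extension of characteristic zero, finitely many elements lie in a field
generated by a single nonzero element. -/
lemma exists_ne_zero_forall_mem_adjoin_simple {K E ι : Type*} [Field K] [CharZero K] [Field E]
    [Algebra K E] [Algebra.IsAlgebraic K E] [Finite ι] (lam : ι → E) :
    ∃ θ : E, θ ≠ 0 ∧ ∀ i, lam i ∈ IntermediateField.adjoin K {θ} := by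
  let F := IntermediateField.adjoin K (Set.range lam)
  have : FiniteDimensional K F :=
    IntermediateField.finiteDimensional_adjoin
      fun x _ => (Algebra.IsAlgebraic.isAlgebraic (R := K) x).isIntegral
  obtain ⟨α, hα⟩ := Field.exists_primitive_element K F
  have hmem : ∀ i, lam i ∈ IntermediateField.adjoin K {(α : E)} := by
    intro i
    have hi : lam i ∈ F := IntermediateField.subset_adjoin K _ ⟨i, rfl⟩
    have h1 : IntermediateField.lift (IntermediateField.adjoin K {α}) = F := by
      rw [hα, IntermediateField.lift_top]
    rw [IntermediateField.lift_adjoin_simple] at h1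
    rw [h1]
    exact hi
  by_cases h0 : (α : E) = 0
  · refine ⟨1, one_ne_zero, fun i => ?_⟩
    have := hmem i
    rw [h0, IntermediateField.adjoin_zero] at this
    rwa [IntermediateField.adjoin_one]
  · exact ⟨α, h0, hmem⟩

/-- In a `k + 1`-dimensional coordinate space, any linear functional vanishes on `k` linearly
independent vectors. -/
lemma exists_linearIndependent_ker {K : Type*} [Field K] {k : ℕ}
    (f : (Fin (k + 1) → K) →ₗ[K] K) :
    ∃ γ : Fin k → LinearMap.ker f, LinearIndependent K γ := by
  apply exists_linearIndependent_of_le_finrank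
  have h1 := LinearMap.finrank_range_add_finrank_ker f
  have h2 : Module.finrank K (LinearMap.range f) ≤ 1 := by
    simpa using (LinearMap.range f).finrank_le
  rw [Module.finrank_fin_fun] at h1
  omega

/-- An instance is MSTV-reducible if a coordinate `t₀` can be dropped so that the remaining
coordinates are those of a smaller system of roots and multiplicities, for which reducibility is
known with one sequence less. -/
lemma MSTVReducible.of_drop_coordinate {d k : ℕ} (hk : 1 ≤ k)
    (h : ∀ I : ExpPolyInstance d k, MSTVReducible I)
    (J : ExpPolyInstance (d + 1) (k + 1)) (t₀ : (i : Fin J.s) × Fin (J.m i))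
    {s' : ℕ} (e : Fin s' → Fin J.s) (he : Function.Injective e) (m' : Fin s' → ℕ)
    (hm' : ∀ i, 1 ≤ m' i) (hsum : ∑ i, m' i ≤ d)
    (φ : ((i : Fin s') × Fin (m' i)) → ((i : Fin J.s) × Fin (J.m i)))
    (hφ : ∀ t, (φ t).1 = e t.1)
    (hrange : ∀ t, t ≠ t₀ → ∃ t', φ t' = t) :
    MSTVReducible J := by
  let ψ := Fintype.linearCombination Qbar J.coeff
  have hψ : Function.Injective ψ := by
    have := J.indep
    rwa [linearIndependent_iff_injective_fintypeLinearCombination] at this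
  let f : (Fin (k + 1) → Qbar) →ₗ[Qbar] Qbar := LinearMap.proj t₀ ∘ₗ ψ
  obtain ⟨γ, hγ⟩ := exists_linearIndependent_ker f
  let ρ : LinearMap.ker f →ₗ[Qbar] (((i : Fin s') × Fin (m' i)) → Qbar) :=
    LinearMap.funLeft Qbar Qbar φ ∘ₗ ψ ∘ₗ (LinearMap.ker f).subtype
  have hvanish : ∀ x : LinearMap.ker f, ψ x.1 t₀ = 0 := fun x => x.2
  have hρ : LinearMap.ker ρ = ⊥ := by
    rw [LinearMap.ker_eq_bot']
    intro x hx
    have h0 : ψ x.1 = 0 := by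
      funext t
      by_cases ht : t = t₀
      · rw [ht]; exact hvanish x
      · obtain ⟨t', rfl⟩ := hrange t ht
        exact congrFun hx t'
    exact Subtype.ext (hψ (by rw [h0]; simp))
  have hind : LinearIndependent Qbar (ρ ∘ γ) := hγ.map' ρ hρ
  obtain ⟨i₀⟩ : Nonempty (Fin s') := by
    obtain ⟨t, -⟩ := Function.ne_iff.mp (hind.ne_zero ⟨0, hk⟩)
    exact ⟨t.1⟩
  have : Algebra.IsAlgebraic ℚ Qbar := AlgebraicClosure.isAlgebraic ℚ
  obtain ⟨θ, hθ0, hθ⟩ := exists_ne_zero_forall_mem_adjoin_simple (K := ℚ) J.lam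
  -- Rescaling all roots by `c` makes one of them generate a field containing every root of `J`.
  let c := θ / J.lam (e i₀)
  have hc : c ≠ 0 := div_ne_zero hθ0 (J.lam_ne_zero _)
  have hcθ : c * J.lam (e i₀) = θ := div_mul_cancel₀ _ (J.lam_ne_zero _)
  let I : ExpPolyInstance d k :=
    { s := s'
      lam := fun i => c * J.lam (e i)
      m := m'
      coeff := ρ ∘ γ
      lam_ne_zero := fun i => mul_ne_zero hc (J.lam_ne_zero _)
      lam_injective := fun i j hij => he (J.lam_injective (mul_left_cancel₀ hc hij))
      nondeg := fun i j hij n hn => by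
        rw [mul_div_mul_left _ _ hc]
        exact J.nondeg _ _ (he.ne hij) n hn
      m_pos := hm'
      order_le := hsum
      indep := hind }
  obtain ⟨β, -, hw0, L, hmem, hfin, v, hv, hna, har⟩ := h I
  let x : LinearMap.ker f := ∑ q, β q • γ q
  have hx : ∑ q, β q • I.coeff q = ρ x := by
    simp [x, I, map_sum]
  have hxw : ∑ p, x.1 p • J.coeff p = ψ x.1 := (Fintype.linearCombination_apply _ _ _).symm
  rw [hx] at hw0
  simp only [hx] at hna har
  have hψx : ψ x.1 ≠ 0 := by
    intro h0
    apply hw0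
    funext t
    exact congrFun h0 (φ t)
  have hθL : θ ∈ L := by
    have := hmem i₀
    rwa [show I.lam i₀ = θ from hcθ] at this
  have hL : ∀ i, J.lam i ∈ L := fun i =>
    (IntermediateField.adjoin_simple_le_iff.mpr hθL) (hθ i)
  have hcL : c ∈ L := L.div_mem hθL (hL _)
  have hvmul : ∀ i : Fin s', v ⟨I.lam i, hmem i⟩ = v ⟨c, hcL⟩ * v ⟨J.lam (e i), hL (e i)⟩ := by
    intro i
    rw [← map_mul]
    rfl
  have hvc : 0 < v ⟨c, hcL⟩ := v.pos fun h0 => hc (congrArg Subtype.val h0)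
  have hρ_ne : ∀ i j, ψ x.1 ⟨i, j⟩ ≠ 0 → ∃ i', e i' = i ∧ ∃ j', ρ x ⟨i', j'⟩ ≠ 0 := by
    intro i j hij
    obtain ⟨⟨i', j'⟩, hij'⟩ := hrange ⟨i, j⟩ fun h0 => hij (h0 ▸ hvanish x)
    refine ⟨i', ?_, j', ?_⟩
    · rw [← hφ ⟨i', j'⟩, hij']
    · change ψ x.1 (φ ⟨i', j'⟩) ≠ 0
      rwa [hij']
  have hne_ρ : ∀ i' j', ρ x ⟨i', j'⟩ ≠ 0 → ∃ j, ψ x.1 ⟨e i', j⟩ ≠ 0 := by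
    intro i' j' hij
    have h1 : ψ x.1 (φ ⟨i', j'⟩) ≠ 0 := hij
    rw [← hφ ⟨i', j'⟩]
    exact ⟨(φ ⟨i', j'⟩).2, h1⟩
  have hcard : (Finset.univ.filter (fun i : Fin J.s =>
          (∃ j, ψ x.1 ⟨i, j⟩ ≠ 0) ∧
          ∀ i' : Fin J.s, (∃ j', ψ x.1 ⟨i', j'⟩ ≠ 0) →
            v ⟨J.lam i', hL i'⟩ ≤ v ⟨J.lam i, hL i⟩)).card ≤
      (Finset.univ.filter (fun i : Fin s' =>
          (∃ j, ρ x ⟨i, j⟩ ≠ 0) ∧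
          ∀ i' : Fin s', (∃ j', ρ x ⟨i', j'⟩ ≠ 0) →
            v ⟨I.lam i', hmem i'⟩ ≤ v ⟨I.lam i, hmem i⟩)).card := by
    rw [← Finset.card_map ⟨e, he⟩]
    apply Finset.card_le_card
    intro i hi
    obtain ⟨⟨j, hj⟩, hmax⟩ := (Finset.mem_filter.mp hi).2
    obtain ⟨i', rfl, hi'⟩ := hρ_ne i j hj
    refine Finset.mem_map.mpr ⟨i', Finset.mem_filter.mpr ⟨Finset.mem_univ _, hi', ?_⟩, rfl⟩
    rintro i'' ⟨j'', hj''⟩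
    rw [hvmul, hvmul]
    exact mul_le_mul_of_nonneg_left (hmax _ (hne_ρ _ _ hj'')) hvc.le
  refine ⟨x.1, fun h0 => hψx (by rw [h0, map_zero]), ?_⟩
  rw [hxw]
  exact ⟨hψx, L, hL, hfin, v, hv, fun hn => hcard.trans (hna hn), fun hn => hcard.trans (har hn)⟩

/-- If every exponential-polynomial instance of order at most `d` with `k`
sequences is MSTV-reducible, then so is every instance of order at most `d+1` with `k+1`
sequences. -/
theorem mstv_reducible_grow (d k : ℕ) (hk : 1 ≤ k) (hkd : k ≤ d)
    (h : ∀ I : ExpPolyInstance d k, MSTVReducible I) :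
    ∀ J : ExpPolyInstance (d + 1) (k + 1), MSTVReducible J := by
  intro J
  obtain ⟨i₀⟩ : Nonempty (Fin J.s) := by
    obtain ⟨t, -⟩ := Function.ne_iff.mp (J.indep.ne_zero 0)
    exact ⟨t.1⟩
  have hpos := J.m_pos i₀
  have hle := J.order_le
  have hlast : J.m i₀ - 1 < J.m i₀ := by omega
  by_cases h2 : 2 ≤ J.m i₀
  · have hle' : ∀ i, Function.update J.m i₀ (J.m i₀ - 1) i ≤ J.m i := by
      intro i
      by_cases hi : i = i₀
      · subst hi; simp
      · simp [hi]
    refine MSTVReducible.of_drop_coordinate hk h J ⟨i₀, J.m i₀ - 1, hlast⟩ id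
      Function.injective_id (Function.update J.m i₀ (J.m i₀ - 1)) ?_ ?_
      (fun t => ⟨t.1, Fin.castLE (hle' t.1) t.2⟩) (fun _ => rfl) ?_
    · intro i
      by_cases hi : i = i₀
      · subst hi; simp; omega
      · simpa [hi] using J.m_pos i
    · have h1 := Finset.sum_update_of_mem (Finset.mem_univ i₀) J.m (J.m i₀ - 1)
      have h3 := Finset.sum_eq_add_sum_sdiff_singleton_of_mem (Finset.mem_univ i₀) J.m
      omega
    · rintro ⟨i, j, hj⟩ hij
      have hj' : j < Function.update J.m i₀ (J.m i₀ - 1) i := by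
        by_cases hi : i = i₀
        · subst hi
          have : j ≠ J.m i - 1 := fun h0 => hij (by subst h0; rfl)
          simp; omega
        · simpa [hi] using hj
      exact ⟨⟨i, j, hj'⟩, rfl⟩
  · have h1 : J.m i₀ = 1 := by omega
    obtain ⟨n, hn⟩ : ∃ n, J.s = n + 1 := Nat.exists_eq_add_one.mpr i₀.pos
    let e : Fin n → Fin J.s := fun i => Fin.cast hn.symm ((Fin.cast hn i₀).succAbove i)
    have he : Function.Injective e :=
      (Fin.cast_injective _).comp Fin.succAbove_right_injective
    refine MSTVReducible.of_drop_coordinate hk h J ⟨i₀, J.m i₀ - 1, hlast⟩ e he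
      (J.m ∘ e) (fun _ => J.m_pos _) ?_ (fun t => ⟨e t.1, t.2⟩) (fun _ => rfl) ?_
    · have h3 : ∑ i, J.m i = ∑ i : Fin (n + 1), J.m (Fin.cast hn.symm i) :=
        ((finCongr hn.symm).sum_comp J.m).symm
      rw [Fin.sum_univ_succAbove _ (Fin.cast hn i₀)] at h3
      have h4 : J.m (Fin.cast hn.symm (Fin.cast hn i₀)) = 1 := h1
      change ∑ i, J.m (e i) ≤ d
      have h5 : ∑ i, J.m i = 1 + ∑ i, J.m (e i) := by rw [h3, h4]
      omega
    · rintro ⟨i, j⟩ hij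
      have hi : i ≠ i₀ := by
        rintro rfl
        exact hij (Sigma.ext rfl (heq_of_eq (Fin.ext (by have := j.2; simp; omega))))
      obtain ⟨i', hi'⟩ := Fin.exists_succAbove_eq (x := Fin.cast hn i) (y := Fin.cast hn i₀)
        fun h0 => hi (Fin.cast_injective hn h0)
      obtain rfl : e i' = i := by simp [e, hi']
      exact ⟨⟨i', j⟩, rfl⟩

end
end

section
/- For all integers d, k with 1 ≤ k ≤ d and 0 ≤ d − k ≤ 3, every exponential-polynomial instance of order at most d with k sequences is MSTV-reducible. -/
open scoped Classical

noncomputable section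

/-- A nonzero element of a number field that is not a root of unity but has absolute value `1`
at every complex embedding has absolute value `≠ 1` at some non-Archimedean place. -/
theorem exists_isNonarch_ne_one {K : Type*} [Field K] [NumberField K] {u : K}
    (hu : ∀ n : ℕ, 1 ≤ n → u ^ n ≠ 1) (harch : ∀ φ : K →+* ℂ, ‖φ u‖ = 1) :
    ∃ v : AbsoluteValue K ℝ, IsNonarch v ∧ v u ≠ 1 := by
  by_contra! h
  have hint : IsIntegral ℤ u := by
    obtain ⟨y, rfl⟩ := IsDedekindDomain.HeightOneSpectrum.mem_integers_of_valuation_le_one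
      (R := NumberField.RingOfIntegers K) K u fun v => by
        have hv := h (v.adicAbv (NumberField.HeightOneSpectrum.one_lt_absNorm_nnreal v))
          (v.isNonarchimedean_adicAbv _)
        exact (WithZeroMulInt.toNNReal_le_one_iff
          (NumberField.HeightOneSpectrum.one_lt_absNorm_nnreal v)).1 hv.le
    exact y.isIntegral_coe
  obtain ⟨n, hn, hun⟩ := NumberField.Embeddings.pow_eq_one_of_norm_eq_one K ℂ hint harch
  exact hu n hn hun

/-- Complex conjugation on the image of a Galois number field is induced by an automorphism. -/
theorem exists_algEquiv_eq_conj {K : Type*} [Field K] [NumberField K] [IsGalois ℚ K]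
    (φ : K →+* ℂ) : ∃ τ : K ≃ₐ[ℚ] K, ∀ x, φ (τ x) = starRingEnd ℂ (φ x) := by
  obtain ⟨σ, hσ⟩ := NumberField.ComplexEmbedding.exists_comp_symm_eq_of_comp_eq (k := ℚ) φ
    ((starRingEnd ℂ).comp φ) (by ext; simp)
  exact ⟨σ.symm, fun x => by simpa using RingHom.congr_fun hσ x⟩

/-- The absolute value induced by a complex embedding is Archimedean. -/
theorem not_isNonarch_place {K : Type*} [Field K] [CharZero K] (φ : K →+* ℂ) :
    ¬ IsNonarch (NumberField.place φ) := fun h => by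
  have := h 1 1
  rw [one_add_one_eq_two, map_one, max_self, NumberField.place_apply, map_ofNat] at this
  norm_num at this

/-- The absolute value induced by a complex embedding is nontrivial. -/
theorem absNontrivial_place {K : Type*} [Field K] [CharZero K] (φ : K →+* ℂ) :
    AbsNontrivial (NumberField.place φ) :=
  ⟨2, two_ne_zero, by rw [NumberField.place_apply, map_ofNat]; norm_num⟩

/-- If `f` is not constant on `S`, and `f` and `g` induce opposite orders, then the sets of
maximizers of `f` and of `g` on `S` are disjoint. -/
theorem card_argmax_add_card_argmax_le {ι : Type*} {S : Finset ι} {f g : ι → ℝ}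
    (hfg : ∀ i ∈ S, ∀ j ∈ S, g i ≤ g j → f j ≤ f i) (hne : ∃ i ∈ S, ∃ j ∈ S, f i ≠ f j) :
    (S.filter fun i => ∀ j ∈ S, f j ≤ f i).card + (S.filter fun i => ∀ j ∈ S, g j ≤ g i).card
      ≤ S.card := by
  rw [← Finset.card_union_of_disjoint]
  · exact Finset.card_le_card (Finset.union_subset (Finset.filter_subset _ _)
      (Finset.filter_subset _ _))
  · rw [Finset.disjoint_left]
    intro i hi hi'
    simp only [Finset.mem_filter] at hi hi'
    obtain ⟨a, ha, b, hb, hab⟩ := hne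
    have key : ∀ c ∈ S, f c = f i := fun c hc =>
      le_antisymm (hi.2 c hc) (hfg c hc i hi.1 (hi'.2 c hc))
    exact hab ((key a ha).trans (key b hb).symm)

/-- At most four nonzero elements of a Galois number field, with no ratio a root of unity, admit a
nontrivial absolute value with at most two (non-Archimedean case) or three (Archimedean case)
dominant elements. -/
theorem exists_absoluteValue_card_argmax_le {K : Type*} [Field K] [NumberField K] [IsGalois ℚ K]
    {ι : Type*} (lam : ι → K) (h0 : ∀ i, lam i ≠ 0)
    (hdeg : ∀ i j, i ≠ j → ∀ n : ℕ, 1 ≤ n → (lam i / lam j) ^ n ≠ 1)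
    (S : Finset ι) (hS : S.card ≤ 4) :
    ∃ v : AbsoluteValue K ℝ, AbsNontrivial v ∧
      (IsNonarch v → (S.filter fun i => ∀ j ∈ S, v (lam j) ≤ v (lam i)).card ≤ 2) ∧
      (¬ IsNonarch v → (S.filter fun i => ∀ j ∈ S, v (lam j) ≤ v (lam i)).card ≤ 3) := by
  by_cases harch : ∃ φ : K →+* ℂ,
      (S.filter fun i => ∀ j ∈ S, NumberField.place φ (lam j) ≤ NumberField.place φ (lam i)).card ≤ 3
  · obtain ⟨φ, hφ⟩ := harch
    exact ⟨NumberField.place φ, absNontrivial_place φ, fun h => (not_isNonarch_place φ h).elim,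
      fun _ => hφ⟩
  push Not at harch
  have heq : ∀ (φ : K →+* ℂ), ∀ i ∈ S, ∀ j ∈ S, ‖φ (lam i)‖ = ‖φ (lam j)‖ := by
    intro φ i hi j hj
    have hfil := Finset.eq_of_subset_of_card_le (Finset.filter_subset _ _)
      (hS.trans (Nat.succ_le_of_lt (harch φ)))
    rw [Finset.filter_eq_self] at hfil
    exact le_antisymm (hfil j hj i hi) (hfil i hi j hj)
  obtain ⟨φ⟩ : Nonempty (K →+* ℂ) := inferInstance
  have hcard : 1 < S.card := by
    have := (harch φ).trans_le (Finset.card_filter_le _ _)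
    omega
  obtain ⟨a, ha, b, hb, hab⟩ := Finset.one_lt_card.1 hcard
  obtain ⟨v, hv, hvne⟩ := exists_isNonarch_ne_one (hdeg a b hab) fun ψ => by
    rw [map_div₀, norm_div, heq ψ a ha b hb, div_self]
    simpa using h0 b
  obtain ⟨τ, hτ⟩ := exists_algEquiv_eq_conj φ
  have hτu : ∀ i ∈ S, ∀ j ∈ S, τ (lam i) * lam i = τ (lam j) * lam j := by
    intro i hi j hj
    apply φ.injective
    rw [map_mul, map_mul, hτ, hτ, Complex.conj_mul', Complex.conj_mul', heq φ i hi j hj]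
  have hvab : v (lam a) ≠ v (lam b) := fun h => hvne (by
    rw [map_div₀, h, div_self]
    simpa using h0 b)
  let v' : AbsoluteValue K ℝ := v.comp (f := (τ : K →+* K)) τ.injective
  have hv'_apply : ∀ x, v' x = v (τ x) := fun _ => rfl
  have hvv' : ∀ i ∈ S, ∀ j ∈ S, v' (lam i) ≤ v' (lam j) → v (lam j) ≤ v (lam i) := by
    intro i hi j hj hle
    have h : v' (lam i) * v (lam i) = v' (lam j) * v (lam j) := by
      simpa [hv'_apply] using congrArg v (hτu i hi j hj)
    by_contra! hlt
    exact (mul_lt_mul' hle hlt (v.nonneg _) (v'.pos (h0 j))).ne h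
  have hsum := card_argmax_add_card_argmax_le hvv' ⟨a, ha, b, hb, hvab⟩
  by_cases h2 : (S.filter fun i => ∀ j ∈ S, v (lam j) ≤ v (lam i)).card ≤ 2
  · exact ⟨v, ⟨_, div_ne_zero (h0 a) (h0 b), hvne⟩, fun _ => h2, fun h => (h hv).elim⟩
  · refine ⟨v', ⟨τ.symm (lam a / lam b), by simp [h0], by simpa [hv'_apply] using hvne⟩,
      fun _ => by omega, fun h => (h ?_).elim⟩
    intro x y
    simpa [hv'_apply] using hv (τ x) (τ y)

/-- Among the combinations of `k` linearly independent vectors indexed by `T`, some nonzero one is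
supported on at most `|T| - k + 1` coordinates. -/
theorem exists_combination_card_support_le {F T : Type*} [Field F] [Fintype T] {k r : ℕ}
    (c : Fin k → T → F) (hc : LinearIndependent F c) (hr : Fintype.card T < k + r) (hk : 0 < k) :
    ∃ β : Fin k → F, β ≠ 0 ∧ ∑ p, β p • c p ≠ 0 ∧
      (Finset.univ.filter fun t => (∑ p, β p • c p) t ≠ 0).card ≤ r := by
  obtain ⟨Z, -, hZ⟩ := Finset.exists_subset_card_eq
    (s := (Finset.univ : Finset T)) (n := Fintype.card T - r) (by simp)
  let A : (Fin k → F) →ₗ[F] (Z → F) :=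
    (LinearMap.funLeft F F ((↑) : Z → T)).comp (Fintype.linearCombination F c)
  have hA : LinearMap.ker A ≠ ⊥ := A.ker_ne_bot_of_finrank_lt (by simp [hZ]; omega)
  obtain ⟨β, hβ, hβ0⟩ := (Submodule.ne_bot_iff _).1 hA
  refine ⟨β, hβ0, fun h => hβ0 (funext (Fintype.linearIndependent_iff.1 hc β h)), ?_⟩
  calc _ ≤ Zᶜ.card := Finset.card_le_card fun t ht => by
        rw [Finset.mem_compl]
        intro htZ
        have := congrFun hβ ⟨t, htZ⟩
        simp only [A, LinearMap.comp_apply, LinearMap.funLeft_apply,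
          Fintype.linearCombination_apply] at this
        exact (Finset.mem_filter.1 ht).2 this
    _ ≤ r := by rw [Finset.card_compl, hZ]; omega

/-- Finitely many elements of a normal extension in characteristic zero lie in a common finite
Galois subextension. -/
theorem exists_finite_galois_intermediateField {F E ι : Type*} [Field F] [CharZero F] [Field E]
    [Algebra F E] [Normal F E] [Finite ι] (x : ι → E) :
    ∃ L : IntermediateField F E, (∀ i, x i ∈ L) ∧ FiniteDimensional F L ∧ IsGalois F L := by
  have : FiniteDimensional F (IntermediateField.adjoin F (Set.range x)) :=
    IntermediateField.finiteDimensional_adjoin fun y _ => Algebra.IsIntegral.isIntegral y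
  exact ⟨IntermediateField.normalClosure F (IntermediateField.adjoin F (Set.range x)) E,
    fun i => IntermediateField.le_normalClosure _
      (IntermediateField.subset_adjoin F _ (Set.mem_range_self i)),
    inferInstance, ⟨⟩⟩

/-- `ℚ̄` is normal over `ℚ`, for the canonical `ℚ`-algebra structure of a field of characteristic
zero. -/
instance normal_rat_qbar : Normal ℚ Qbar := by
  have h : @Normal ℚ Qbar _ _ (AlgebraicClosure.instAlgebra ℚ) := IsAlgClosure.normal ℚ _
  rwa [Subsingleton.elim (AlgebraicClosure.instAlgebra ℚ : Algebra ℚ Qbar)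
    DivisionRing.toRatAlgebra] at h

/-- For `1 ≤ k ≤ d` with `d - k ≤ 3`, every exponential-polynomial instance
of order at most `d` with `k` sequences is MSTV-reducible. -/
theorem mstv_reducible_of_codim_le_three (d k : ℕ) (hk : 1 ≤ k) (hkd : k ≤ d)
    (hdk : d - k ≤ 3) :
    ∀ I : ExpPolyInstance d k, MSTVReducible I := by
  intro I
  obtain ⟨β, hβ, hw, hcard⟩ := exists_combination_card_support_le (r := 4) I.coeff I.indep
    (by have := I.order_le; simp only [Fintype.card_sigma, Fintype.card_fin]; omega) hk
  refine ⟨β, hβ, hw, ?_⟩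
  generalize ∑ p, β p • I.coeff p = w at hcard
  obtain ⟨L, hmem, hfin, hgal⟩ := exists_finite_galois_intermediateField (F := ℚ) I.lam
  have : NumberField L :=
    { to_charZero := inferInstance
      to_finiteDimensional := by convert hfin }
  have : @IsGalois ℚ _ L _ DivisionRing.toRatAlgebra := by
    rwa [Subsingleton.elim (DivisionRing.toRatAlgebra : Algebra ℚ L) L.algebra']
  let S : Finset (Fin I.s) := Finset.univ.filter fun i => ∃ j, w ⟨i, j⟩ ≠ 0
  have hS : S.card ≤ 4 := by
    refine (Finset.card_le_card (t := (Finset.univ.filter fun t => w t ≠ 0).image Sigma.fst)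
      fun i hi => ?_).trans (Finset.card_image_le.trans hcard)
    obtain ⟨j, hj⟩ := (Finset.mem_filter.1 hi).2
    exact Finset.mem_image.2 ⟨⟨i, j⟩, by simpa using hj, rfl⟩
  obtain ⟨v, hv, hna, harch⟩ := exists_absoluteValue_card_argmax_le
    (fun i => (⟨I.lam i, hmem i⟩ : L)) (fun i h => I.lam_ne_zero i (congrArg Subtype.val h))
    (fun i j hij n hn h => I.nondeg i j hij n hn (by simpa using congrArg Subtype.val h)) S hS
  simp only [S, Finset.filter_filter, Finset.mem_filter, Finset.mem_univ, true_and] at hna harch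
  exact ⟨L, hmem, hfin, v, hv, hna, harch⟩

end
end

section
/- Every exponential-polynomial instance of order at most 12 with 6 sequences is MSTV-reducible. (This is the paper's theorem that SimSkolem(12,6) is MSTV-reducible, hence decidable, and equivalently that the reduced Subspace Orbit Problem with inherent dimension 12 and target dimension 6 is decidable.) -/
open scoped Classical

noncomputable section

/-- A number field element taking value `1` at every nontrivial absolute value is a root of
unity. -/
lemma exists_pow_eq_one_of_forall_absoluteValue {L : Type*} [Field L] [NumberField L] {z : L}
    (hz0 : z ≠ 0) (hz : ∀ w : AbsoluteValue L ℝ, AbsNontrivial w → w z = 1) :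
    ∃ n : ℕ, 1 ≤ n ∧ z ^ n = 1 := by
  have hz' (w : AbsoluteValue L ℝ) : w z = 1 := by
    by_contra h
    exact h (hz w ⟨z, hz0, h⟩)
  have hint : IsIntegral ℤ z := by
    have hmem := IsDedekindDomain.HeightOneSpectrum.mem_integers_of_valuation_le_one
      (R := NumberField.RingOfIntegers L) L z fun P ↦ by
        have h := (hz' (NumberField.HeightOneSpectrum.adicAbv L P)).le
        rwa [NumberField.HeightOneSpectrum.adicAbv_def,
          ← NNReal.coe_one, NNReal.coe_le_coe, WithZeroMulInt.toNNReal_le_one_iff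
            (NumberField.HeightOneSpectrum.one_lt_absNorm_nnreal P)] at h
    obtain ⟨y, hy⟩ := hmem
    exact hy ▸ y.isIntegral_coe
  obtain ⟨n, hn, h⟩ := NumberField.Embeddings.pow_eq_one_of_norm_eq_one L ℂ hint
    fun φ ↦ hz' (NumberField.place φ)
  exact ⟨n, hn, h⟩

/-- Nonzero elements of a number field whose ratio is not a root of unity are separated by some
nontrivial absolute value. -/
lemma exists_absoluteValue_ne {L : Type*} [Field L] [NumberField L] {x y : L}
    (hx : x ≠ 0) (hy : y ≠ 0) (h : ∀ n : ℕ, 1 ≤ n → (x / y) ^ n ≠ 1) :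
    ∃ w : AbsoluteValue L ℝ, AbsNontrivial w ∧ w x ≠ w y := by
  by_contra! hw
  obtain ⟨n, hn, hpow⟩ := exists_pow_eq_one_of_forall_absoluteValue (div_ne_zero hx hy)
    fun w hwn ↦ by rw [map_div₀, hw w hwn, div_self (w.ne_zero hy)]
  exact h n hn hpow

/-- A Galois number field has an Archimedean absolute value together with an automorphism which
acts as complex conjugation for that absolute value. -/
lemma exists_archimedean_conj (L : Type*) [Field L] [NumberField L] [IsGalois ℚ L] :
    ∃ (v : AbsoluteValue L ℝ) (c : L ≃+* L), AbsNontrivial v ∧ ¬ IsNonarch v ∧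
      ∀ x y, v x = v y → c x * x = c y * y := by
  obtain ⟨φ⟩ : Nonempty (L →+* ℂ) := inferInstance
  obtain ⟨σ, hσ⟩ := NumberField.ComplexEmbedding.exists_comp_symm_eq_of_comp_eq (k := ℚ) φ
    (NumberField.ComplexEmbedding.conjugate φ) (by ext; simp)
  have h2 : NumberField.place φ (2 : L) = 2 := by
    rw [NumberField.place_apply, map_ofNat, Complex.norm_ofNat]
  refine ⟨NumberField.place φ, σ.symm.toRingEquiv, ⟨2, two_ne_zero, by rw [h2]; norm_num⟩, ?_, ?_⟩
  · intro h
    have := h 1 1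
    rw [one_add_one_eq_two, h2] at this
    norm_num at this
  · intro x y hxy
    have key (z : L) : φ (σ.symm z * z) = ((NumberField.place φ z ^ 2 : ℝ) : ℂ) := by
      have hz : φ (σ.symm z) = starRingEnd ℂ (φ z) := congrArg (fun f : L →+* ℂ ↦ f z) hσ
      rw [map_mul, hz, NumberField.place_apply, mul_comm, Complex.mul_conj']
      push_cast
      rfl
    apply φ.injective
    exact (key x).trans ((by rw [hxy]) : _ = _) |>.trans (key y).symm

section Codes

open Module

variable {K T ι : Type*} [Field K] [Fintype T] [Fintype ι]

/-- The coordinates at which some vector of `U` does not vanish. -/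
def codeSupport (U : Submodule K (T → K)) : Finset T :=
  Finset.univ.filter fun t ↦ ∃ x ∈ U, x t ≠ 0

/-- The vectors of `U` which vanish on `X`. -/
def shorten (U : Submodule K (T → K)) (X : Finset T) : Submodule K (T → K) :=
  U ⊓ ⨅ t ∈ X, LinearMap.ker (LinearMap.proj t)

/-- The elements of `S` at which `h` attains its maximum over `S`. -/
def topSet (h : T → ℝ) (S : Finset T) : Finset T :=
  S.filter fun t ↦ ∀ t' ∈ S, h t' ≤ h t

/-- The `h`-dominant blocks met by the support of `x`, where `π` sends a coordinate to its
block. -/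
def dominantBlocks (π : T → ι) (h : ι → ℝ) (x : T → K) : Finset ι :=
  Finset.univ.filter fun i ↦
    (∃ t, π t = i ∧ x t ≠ 0) ∧ ∀ i', (∃ t, π t = i' ∧ x t ≠ 0) → h i' ≤ h i

omit [Fintype T] in
lemma ne_bot_of_finrank_pos {U : Submodule K (T → K)} (hU : 0 < finrank K U) : U ≠ ⊥ := by
  rintro rfl
  simp at hU

lemma mem_codeSupport {U : Submodule K (T → K)} {t : T} :
    t ∈ codeSupport U ↔ ∃ x ∈ U, x t ≠ 0 := by
  simp [codeSupport]

omit [Fintype T] in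
lemma mem_shorten {U : Submodule K (T → K)} {X : Finset T} {x : T → K} :
    x ∈ shorten U X ↔ x ∈ U ∧ ∀ t ∈ X, x t = 0 := by
  simp [shorten]

omit [Fintype T] in
lemma shorten_le (U : Submodule K (T → K)) (X : Finset T) : shorten U X ≤ U :=
  inf_le_left

lemma mem_topSet {h : T → ℝ} {S : Finset T} {t : T} :
    t ∈ topSet h S ↔ t ∈ S ∧ ∀ t' ∈ S, h t' ≤ h t := by
  simp [topSet]

lemma topSet_nonempty (h : T → ℝ) {S : Finset T} (hS : S.Nonempty) : (topSet h S).Nonempty := by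
  obtain ⟨t, ht, hmax⟩ := S.exists_max_image h hS
  exact ⟨t, mem_topSet.2 ⟨ht, hmax⟩⟩

lemma codeSupport_mono {U V : Submodule K (T → K)} (h : U ≤ V) :
    codeSupport U ⊆ codeSupport V := fun t ht ↦ by
  obtain ⟨x, hx, hxt⟩ := mem_codeSupport.1 ht
  exact mem_codeSupport.2 ⟨x, h hx, hxt⟩

lemma codeSupport_nonempty {U : Submodule K (T → K)} (hU : U ≠ ⊥) : (codeSupport U).Nonempty := by
  obtain ⟨x, hx, hx0⟩ := U.ne_bot_iff.1 hU
  obtain ⟨t, ht⟩ := Function.ne_iff.1 hx0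
  exact ⟨t, mem_codeSupport.2 ⟨x, hx, ht⟩⟩

lemma codeSupport_shorten_subset (U : Submodule K (T → K)) (X : Finset T) :
    codeSupport (shorten U X) ⊆ codeSupport U \ X := fun t ht ↦ by
  obtain ⟨x, hx, hxt⟩ := mem_codeSupport.1 ht
  rw [mem_shorten] at hx
  exact Finset.mem_sdiff.2 ⟨mem_codeSupport.2 ⟨x, hx.1, hxt⟩, fun h ↦ hxt (hx.2 t h)⟩

lemma card_codeSupport_shorten_add_card_le {U : Submodule K (T → K)} {X : Finset T}
    (hX : X ⊆ codeSupport U) :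
    (codeSupport (shorten U X)).card + X.card ≤ (codeSupport U).card := by
  have h := Finset.card_le_card (codeSupport_shorten_subset U X)
  rw [Finset.card_sdiff_of_subset hX] at h
  have := Finset.card_le_card hX
  omega

lemma finrank_shorten_lt {U : Submodule K (T → K)} {X : Finset T} (hX : X ⊆ codeSupport U)
    (hne : X.Nonempty) : finrank K (shorten U X) < finrank K U := by
  obtain ⟨t, ht⟩ := hne
  obtain ⟨x, hx, hxt⟩ := mem_codeSupport.1 (hX ht)
  exact Submodule.finrank_lt_finrank_of_lt <| SetLike.lt_iff_le_and_exists.2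
    ⟨shorten_le U X, x, hx, fun h ↦ hxt ((mem_shorten.1 h).2 t ht)⟩

lemma finrank_le_finrank_shorten_add_card (U : Submodule K (T → K)) (X : Finset T) :
    finrank K U ≤ finrank K (shorten U X) + X.card := by
  let f : U →ₗ[K] (X → K) := (LinearMap.funLeft K K Subtype.val).domRestrict U
  have hker : (LinearMap.ker f).map U.subtype = shorten U X := by
    ext x
    simp only [Submodule.mem_map, LinearMap.mem_ker, mem_shorten]
    constructor
    · rintro ⟨y, hy, rfl⟩
      exact ⟨y.2, fun t ht ↦ congrFun hy ⟨t, ht⟩⟩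
    · rintro ⟨hx, h⟩
      exact ⟨⟨x, hx⟩, funext fun t ↦ h t t.2, rfl⟩
  have h1 := f.finrank_range_add_finrank_ker
  have h2 : finrank K (LinearMap.range f) ≤ X.card := by
    simpa using Submodule.finrank_le (LinearMap.range f)
  have h3 : finrank K (LinearMap.ker f) = finrank K (shorten U X) := by
    rw [← hker, Submodule.finrank_map_subtype_eq]
  omega

omit [Fintype T] in
lemma exists_le_finrank_eq {U : Submodule K (T → K)} {n : ℕ} (hn : n ≤ finrank K U) :
    ∃ W ≤ U, finrank K W = n := by
  obtain ⟨f, hf⟩ := exists_linearIndependent_of_le_finrank hn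
  refine ⟨(Submodule.span K (Set.range f)).map U.subtype, Submodule.map_subtype_le _ _, ?_⟩
  rw [Submodule.finrank_map_subtype_eq, finrank_span_eq_card hf, Fintype.card_fin]

lemma dominantBlocks_subset_image {π : T → ι} {h : ι → ℝ} {x : T → K} {S : Finset T}
    (hS : ∀ t, x t ≠ 0 → t ∈ S) {t₀ : T} (ht₀ : t₀ ∈ topSet (h ∘ π) S) (hx : x t₀ ≠ 0) :
    dominantBlocks π h x ⊆ ((topSet (h ∘ π) S).filter fun t ↦ x t ≠ 0).image π := by
  intro i hi
  obtain ⟨⟨t, rfl, ht⟩, hmax⟩ := (Finset.mem_filter.1 hi).2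
  have htop : t ∈ topSet (h ∘ π) S := mem_topSet.2 ⟨hS t ht, fun t' ht' ↦
    ((mem_topSet.1 ht₀).2 t' ht').trans (hmax _ ⟨t₀, rfl, hx⟩)⟩
  exact Finset.mem_image_of_mem π (Finset.mem_filter.2 ⟨htop, ht⟩)

omit [Fintype T] in
lemma card_add_card_add_card_le {S A P Q : Finset T} (hA : A ⊆ S) (hP : P ⊆ S) (hQ : Q ⊆ S)
    (h : ∀ t ∈ A, t ∈ P → t ∉ Q) :
    A.card + P.card + Q.card + (S \ (A ∪ P)).card + (S \ (A ∪ Q)).card ≤ 2 * S.card := by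
  have hcard {X : Finset T} (hX : X ⊆ S) : X.card = ∑ t ∈ S, if t ∈ X then 1 else 0 := by
    rw [← Finset.card_filter, Finset.filter_mem_eq_inter, Finset.inter_eq_right.2 hX]
  rw [hcard hA, hcard hP, hcard hQ, hcard (X := S \ (A ∪ P)) Finset.sdiff_subset,
    hcard (X := S \ (A ∪ Q)) Finset.sdiff_subset, ← Finset.sum_add_distrib,
    ← Finset.sum_add_distrib, ← Finset.sum_add_distrib, ← Finset.sum_add_distrib, mul_comm,
    ← smul_eq_mul, ← Finset.sum_const]
  refine Finset.sum_le_sum fun t ht ↦ ?_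
  have := h t
  simp only [Finset.mem_sdiff, Finset.mem_union]
  split_ifs <;> first | omega | tauto

lemma succ_le_card_codeSupport {U : Submodule K (T → K)} {k n : ℕ}
    (h : ∀ W ≤ U, k ≤ finrank K W → n ≤ (codeSupport W).card) (hU : k + 1 ≤ finrank K U) :
    n + 1 ≤ (codeSupport U).card := by
  obtain ⟨t, ht⟩ := codeSupport_nonempty (U := U) (ne_bot_of_finrank_pos (by omega))
  have h1 := finrank_le_finrank_shorten_add_card U {t}
  have h2 := card_codeSupport_shorten_add_card_le (Finset.singleton_subset_iff.2 ht)
  rw [Finset.card_singleton] at h1 h2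
  have h3 := h _ (shorten_le U {t}) (by omega)
  omega

/-- If every nonzero vector of `U` has more than `n` dominant blocks, then the projection of `U`
to the top coordinates of its support has rank at most their number minus `n`. -/
lemma finrank_add_le_of_lt_card_dominantBlocks {U : Submodule K (T → K)} (hU : U ≠ ⊥)
    (π : T → ι) (h : ι → ℝ) {n : ℕ}
    (hn : ∀ x ∈ U, x ≠ 0 → n < (dominantBlocks π h x).card) :
    finrank K U + n ≤ finrank K (shorten U (topSet (h ∘ π) (codeSupport U))) +
      (topSet (h ∘ π) (codeSupport U)).card := by
  set A := topSet (h ∘ π) (codeSupport U) with hA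
  have hAsub : A ⊆ codeSupport U := Finset.filter_subset _ _
  by_contra! hlt
  obtain ⟨B, hBA, hB⟩ := Finset.exists_subset_card_eq (Nat.sub_le A.card n)
  have hrank : finrank K (shorten U A) < finrank K (shorten U B) := by
    have h1 := finrank_le_finrank_shorten_add_card U B
    have h2 := finrank_shorten_lt hAsub (topSet_nonempty _ (codeSupport_nonempty hU))
    omega
  obtain ⟨x, hxB, hxA⟩ : ∃ x ∈ shorten U B, x ∉ shorten U A := by
    by_contra! hle
    exact hrank.not_ge (Submodule.finrank_mono hle)
  rw [mem_shorten] at hxB hxA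
  obtain ⟨t, htA, ht⟩ : ∃ t ∈ A, x t ≠ 0 := by
    by_contra! hz
    exact hxA ⟨hxB.1, hz⟩
  have hsub := dominantBlocks_subset_image (π := π) (h := h) (x := x) (S := codeSupport U)
    (fun t ht ↦ mem_codeSupport.2 ⟨x, hxB.1, ht⟩) htA ht
  have hle : (A.filter fun t ↦ x t ≠ 0) ⊆ A \ B := fun t ht ↦ by
    rw [Finset.mem_filter] at ht
    exact Finset.mem_sdiff.2 ⟨ht.1, fun hB ↦ ht.2 (hxB.2 t hB)⟩
  have h1 := (Finset.card_le_card hsub).trans (Finset.card_image_le.trans (Finset.card_le_card hle))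
  rw [Finset.card_sdiff_of_subset hBA] at h1
  have h2 := hn x hxB.1 fun h0 ↦ ht (congrFun h0 t)
  omega

/-- The rank constraints which the failure of reducibility imposes on all subspaces of `V`: the
top coordinates `A` for the function `a` have nullity at least `3`, and there are two further
sets `P`, `Q` of nullity at least `2` with `A ∩ P ∩ Q = ∅`. -/
def HasNullSets (a : T → ℝ) (V : Submodule K (T → K)) : Prop :=
  ∀ U ≤ V, U ≠ ⊥ →
    finrank K U + 3 ≤ finrank K (shorten U (topSet a (codeSupport U))) +
      (topSet a (codeSupport U)).card ∧
    ∃ P Q : Finset T,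
      (P.Nonempty ∧ P ⊆ codeSupport U ∧ finrank K U + 2 ≤ finrank K (shorten U P) + P.card) ∧
      (Q.Nonempty ∧ Q ⊆ codeSupport U ∧ finrank K U + 2 ≤ finrank K (shorten U Q) + Q.card) ∧
      ∀ t ∈ topSet a (codeSupport U), t ∈ P → t ∉ Q

/-- Many dominant blocks for `v` and for every member of a separating family `W` closed under
reversing the order on the level sets of `v` give the rank constraints `HasNullSets`. -/
lemma hasNullSets_of_dominantBlocks {V : Submodule K (T → K)} (π : T → ι) (v : ι → ℝ)
    (W : Set (ι → ℝ)) (hpos : ∀ w ∈ W, ∀ i, 0 < w i)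
    (hv : ∀ x ∈ V, x ≠ 0 → 3 < (dominantBlocks π v x).card)
    (hW : ∀ w ∈ W, ∀ x ∈ V, x ≠ 0 → 2 < (dominantBlocks π w x).card)
    (hrev : ∀ w ∈ W, ∃ w' ∈ W, ∀ i j, v i = v j → w' i * w i = w' j * w j)
    (hsep : ∀ i j, i ≠ j → ∃ w ∈ W, w i ≠ w j) :
    HasNullSets (v ∘ π) V := by
  intro U hUV hU
  have hS := codeSupport_nonempty hU
  refine ⟨finrank_add_le_of_lt_card_dominantBlocks hU π v fun x hx ↦ hv x (hUV hx), ?_⟩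
  set A := topSet (v ∘ π) (codeSupport U) with hA
  obtain ⟨i, j, hi, hj, hij⟩ : ∃ i j, i ∈ A.image π ∧ j ∈ A.image π ∧ i ≠ j := by
    obtain ⟨t, ht⟩ := topSet_nonempty (v ∘ π) hS
    obtain ⟨x, hx, hxt⟩ := mem_codeSupport.1 (mem_topSet.1 ht).1
    have hsub := dominantBlocks_subset_image (π := π) (h := v) (x := x) (S := codeSupport U)
      (fun t ht ↦ mem_codeSupport.2 ⟨x, hx, ht⟩) ht hxt
    have h3 := hv x (hUV hx) fun h0 ↦ hxt (congrFun h0 t)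
    obtain ⟨i, hi, j, hj, hij⟩ := Finset.one_lt_card.1 (by omega : 1 < (dominantBlocks π v x).card)
    exact ⟨i, j, Finset.image_subset_image (Finset.filter_subset _ _) (hsub hi),
      Finset.image_subset_image (Finset.filter_subset _ _) (hsub hj), hij⟩
  obtain ⟨ti, hti, rfl⟩ := Finset.mem_image.1 hi
  obtain ⟨tj, htj, rfl⟩ := Finset.mem_image.1 hj
  obtain ⟨w, hw, hwij⟩ := hsep _ _ hij
  obtain ⟨w', hw', hww'⟩ := hrev w hw
  refine ⟨topSet (w ∘ π) (codeSupport U), topSet (w' ∘ π) (codeSupport U),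
    ⟨topSet_nonempty _ hS, Finset.filter_subset _ _,
      finrank_add_le_of_lt_card_dominantBlocks hU π w fun x hx ↦ hW w hw x (hUV hx)⟩,
    ⟨topSet_nonempty _ hS, Finset.filter_subset _ _,
      finrank_add_le_of_lt_card_dominantBlocks hU π w' fun x hx ↦ hW w' hw' x (hUV hx)⟩, ?_⟩
  intro t ht htP htQ
  rw [mem_topSet] at ht htP htQ
  have key (s : T) (hs : s ∈ A) : w (π s) = w (π t) := by
    rw [hA, mem_topSet] at hs
    have hvs : v (π s) = v (π t) := le_antisymm (ht.2 s hs.1) (hs.2 t ht.1)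
    have h1 : w (π s) ≤ w (π t) := htP.2 s hs.1
    have h2 : w' (π s) ≤ w' (π t) := htQ.2 s hs.1
    have h3 := hww' _ _ hvs
    have h4 := hpos w hw (π s)
    have h5 := hpos w' hw' (π t)
    refine le_antisymm h1 (le_of_not_gt fun hlt ↦ ?_)
    nlinarith [mul_le_mul_of_nonneg_right h2 h4.le, mul_lt_mul_of_pos_left hlt h5]
  exact hwij ((key ti hti).trans (key tj htj).symm)

namespace HasNullSets

variable {a : T → ℝ} {V : Submodule K (T → K)}

lemma exists_card_bounds (hV : HasNullSets a V) {U : Submodule K (T → K)} (hUV : U ≤ V)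
    (hU : U ≠ ⊥) :
    ∃ A P Q : Finset T, A = topSet a (codeSupport U) ∧ A ⊆ codeSupport U ∧ P ⊆ codeSupport U ∧
      Q ⊆ codeSupport U ∧ (∀ t ∈ A, t ∈ P → t ∉ Q) ∧
      (∀ X : Finset T, X = A ∨ X = P ∨ X = Q →
        finrank K (shorten U X) < finrank K U ∧
        (codeSupport (shorten U X)).card + X.card ≤ (codeSupport U).card) ∧
      finrank K U + 3 ≤ finrank K (shorten U A) + A.card ∧
      finrank K U + 2 ≤ finrank K (shorten U P) + P.card ∧
      finrank K U + 2 ≤ finrank K (shorten U Q) + Q.card := by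
  obtain ⟨hA, P, Q, ⟨hP, hPS, hPn⟩, ⟨hQ, hQS, hQn⟩, hdisj⟩ := hV U hUV hU
  have hAS : topSet a (codeSupport U) ⊆ codeSupport U := Finset.filter_subset _ _
  refine ⟨_, P, Q, rfl, hAS, hPS, hQS, hdisj, ?_, hA, hPn, hQn⟩
  rintro X (rfl | rfl | rfl)
  · exact ⟨finrank_shorten_lt hAS (topSet_nonempty _ (codeSupport_nonempty hU)),
      card_codeSupport_shorten_add_card_le hAS⟩
  · exact ⟨finrank_shorten_lt hPS hP, card_codeSupport_shorten_add_card_le hPS⟩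
  · exact ⟨finrank_shorten_lt hQS hQ, card_codeSupport_shorten_add_card_le hQS⟩

lemma six_le_card_codeSupport_of_const (hV : HasNullSets a V) {U : Submodule K (T → K)}
    (hUV : U ≤ V) (hU : 1 ≤ finrank K U)
    (hconst : ∀ t ∈ codeSupport U, ∀ t' ∈ codeSupport U, a t' ≤ a t) :
    6 ≤ (codeSupport U).card := by
  obtain ⟨W, hWU, hW⟩ := exists_le_finrank_eq hU
  obtain ⟨A, P, Q, hA, hAS, hPS, hQS, hdisj, hX, hAn, hPn, hQn⟩ :=
    hV.exists_card_bounds (hWU.trans hUV) (ne_bot_of_finrank_pos (by omega))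
  have hAW : A = codeSupport W := hA.trans <| Finset.filter_true_of_mem fun t ht t' ht' ↦
    hconst t (codeSupport_mono hWU ht) t' (codeSupport_mono hWU ht')
  have hc := card_add_card_add_card_le hAS hPS hQS hdisj
  have h1 := hX P (by simp)
  have h2 := hX Q (by simp)
  have h3 := Finset.card_le_card (codeSupport_mono hWU)
  rw [hAW] at hc
  omega

lemma five_le_card_codeSupport (hV : HasNullSets a V) {U : Submodule K (T → K)}
    (hUV : U ≤ V) (hU : 1 ≤ finrank K U) : 5 ≤ (codeSupport U).card := by
  obtain ⟨W, hWU, hW⟩ := exists_le_finrank_eq hU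
  obtain ⟨A, P, Q, -, hAS, hPS, hQS, hdisj, hX, hAn, hPn, hQn⟩ :=
    hV.exists_card_bounds (hWU.trans hUV) (ne_bot_of_finrank_pos (by omega))
  have hc := card_add_card_add_card_le hAS hPS hQS hdisj
  have h1 := hX A (by simp)
  have h2 := hX P (by simp)
  have h3 := hX Q (by simp)
  have h4 := Finset.card_le_card (codeSupport_mono hWU)
  omega

lemma seven_le_card_codeSupport (hV : HasNullSets a V) {U : Submodule K (T → K)}
    (hUV : U ≤ V) (hU : 2 ≤ finrank K U) : 7 ≤ (codeSupport U).card := by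
  obtain ⟨W, hWU, hW⟩ := exists_le_finrank_eq hU
  obtain ⟨A, P, Q, -, hAS, hPS, hQS, hdisj, hX, hAn, hPn, hQn⟩ :=
    hV.exists_card_bounds (hWU.trans hUV) (ne_bot_of_finrank_pos (by omega))
  have hc := card_add_card_add_card_le hAS hPS hQS hdisj
  have hle (X : Finset T) := (shorten_le W X).trans (hWU.trans hUV)
  have h5 (X : Finset T) := hV.five_le_card_codeSupport (hle X)
  have h1 := hX A (by simp)
  have h2 := hX P (by simp)
  have h3 := hX Q (by simp)
  have h4 := Finset.card_le_card (codeSupport_mono hWU)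
  have := h5 A
  have := h5 P
  have := h5 Q
  omega

lemma eight_le_card_codeSupport (hV : HasNullSets a V) {U : Submodule K (T → K)}
    (hUV : U ≤ V) (hU : 3 ≤ finrank K U) : 8 ≤ (codeSupport U).card :=
  succ_le_card_codeSupport (fun _ hW h ↦ hV.seven_le_card_codeSupport (hW.trans hUV) h) hU

lemma ten_le_card_codeSupport (hV : HasNullSets a V) {U : Submodule K (T → K)}
    (hUV : U ≤ V) (hU : 4 ≤ finrank K U) : 10 ≤ (codeSupport U).card := by
  obtain ⟨W, hWU, hW⟩ := exists_le_finrank_eq hU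
  obtain ⟨A, P, Q, -, hAS, hPS, hQS, hdisj, hX, hAn, hPn, hQn⟩ :=
    hV.exists_card_bounds (hWU.trans hUV) (ne_bot_of_finrank_pos (by omega))
  have hc := card_add_card_add_card_le hAS hPS hQS hdisj
  have hle (X : Finset T) := (shorten_le W X).trans (hWU.trans hUV)
  have h4 := Finset.card_le_card (codeSupport_mono hWU)
  have key (X : Finset T) (hXX : X = A ∨ X = P ∨ X = Q)
      (hXn : finrank K W + 2 ≤ finrank K (shorten W X) + X.card) :
      10 ≤ (codeSupport U).card ∨ finrank K (shorten W X) = 0 := by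
    have h1 := hX X hXX
    have := hV.five_le_card_codeSupport (hle X)
    have := hV.seven_le_card_codeSupport (hle X)
    have := hV.eight_le_card_codeSupport (hle X)
    omega
  have := key A (by simp) (by omega)
  have := key P (by simp) (by omega)
  have := key Q (by simp) (by omega)
  omega

lemma eleven_le_card_codeSupport (hV : HasNullSets a V) {U : Submodule K (T → K)}
    (hUV : U ≤ V) (hU : 5 ≤ finrank K U) : 11 ≤ (codeSupport U).card :=
  succ_le_card_codeSupport (fun _ hW h ↦ hV.ten_le_card_codeSupport (hW.trans hUV) h) hU

lemma twelve_lt_card_codeSupport (hV : HasNullSets a V) {U : Submodule K (T → K)}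
    (hUV : U ≤ V) (hU : finrank K U = 6) : 12 < (codeSupport U).card := by
  by_contra! hcard
  obtain ⟨A, P, Q, hA, hAS, hPS, hQS, hdisj, hX, hAn, hPn, hQn⟩ :=
    hV.exists_card_bounds hUV (ne_bot_of_finrank_pos (by omega))
  have hc := card_add_card_add_card_le hAS hPS hQS hdisj
  have hle (X : Finset T) := (shorten_le U X).trans hUV
  have hfive (X : Finset T) := hV.five_le_card_codeSupport (hle X)
  have key (X : Finset T) (hXX : X = A ∨ X = P ∨ X = Q)
      (hXn : finrank K U + 2 ≤ finrank K (shorten U X) + X.card) :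
      finrank K (shorten U X) ≤ 1 := by
    have h1 := hX X hXX
    have := hV.seven_le_card_codeSupport (hle X)
    have := hV.eight_le_card_codeSupport (hle X)
    have := hV.ten_le_card_codeSupport (hle X)
    have := hV.eleven_le_card_codeSupport (hle X)
    omega
  have hAcard : 9 ≤ A.card := by
    have := key A (by simp) (by omega)
    have := hX A (by simp)
    have := hfive A
    omega
  have hP1 := key P (by simp) hPn
  have hQ1 := key Q (by simp) hQn
  have hfalse (X : Finset T) (hXS : X ⊆ codeSupport U) (hX7 : X.card = 7)
      (hXn : finrank K U + 2 ≤ finrank K (shorten U X) + X.card)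
      (hXA : codeSupport U \ (A ∪ X) = ∅) : False := by
    have h6 := hV.six_le_card_codeSupport_of_const (hle X) (by omega) fun t ht t' ht' ↦ by
      have h := Finset.mem_sdiff.1 (codeSupport_shorten_subset U X ht)
      have h' := Finset.mem_sdiff.1 (codeSupport_shorten_subset U X ht')
      have htA : t ∈ A := by
        have := Finset.mem_union.1 (Finset.sdiff_eq_empty_iff_subset.1 hXA h.1)
        tauto
      rw [hA, mem_topSet] at htA
      exact htA.2 t' h'.1
    have := card_codeSupport_shorten_add_card_le hXS
    omega
  rcases (by omega : P.card = 7 ∧ (codeSupport U \ (A ∪ P)).card = 0 ∨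
    Q.card = 7 ∧ (codeSupport U \ (A ∪ Q)).card = 0) with h | h
  · exact hfalse P hPS h.1 hPn (Finset.card_eq_zero.1 h.2)
  · exact hfalse Q hQS h.1 hQn (Finset.card_eq_zero.1 h.2)

end HasNullSets

end Codes

/-- `SimSkolem(12,6)` is MSTV-reducible. -/
theorem mstv_reducible_twelve_six :
    ∀ I : ExpPolyInstance 12 6, MSTVReducible I := by
  intro I
  by_contra hI
  have halg : Algebra.IsAlgebraic ℚ Qbar := by
    have h : (DivisionRing.toRatAlgebra : Algebra ℚ Qbar) = AlgebraicClosure.instAlgebra ℚ :=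
      Subsingleton.elim _ _
    rw [h]
    exact AlgebraicClosure.isAlgebraic ℚ
  have : IsAlgClosure ℚ Qbar := ⟨inferInstance, halg⟩
  have : Normal ℚ Qbar := IsAlgClosure.normal ℚ Qbar
  have : IsGalois ℚ Qbar := ⟨⟩
  let F := IntermediateField.adjoin ℚ (Set.range I.lam)
  have hF : FiniteDimensional ℚ F := IntermediateField.finiteDimensional_adjoin fun x _ ↦
    (Algebra.IsAlgebraic.isAlgebraic x).isIntegral
  let L : IntermediateField ℚ Qbar := IntermediateField.normalClosure ℚ F Qbar
  have hmem (i : Fin I.s) : I.lam i ∈ L :=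
    F.le_normalClosure (IntermediateField.subset_adjoin ℚ _ ⟨i, rfl⟩)
  have hL : FiniteDimensional ℚ L := normalClosure.is_finiteDimensional ℚ F Qbar
  have : NumberField L := ⟨⟩
  have : IsGalois ℚ L := IsGalois.normalClosure ℚ F Qbar
  let μ (i : Fin I.s) : L := ⟨I.lam i, hmem i⟩
  have hμ0 (i : Fin I.s) : μ i ≠ 0 := fun h ↦ I.lam_ne_zero i (congrArg Subtype.val h)
  obtain ⟨v, c, hv, hvna, hc⟩ := exists_archimedean_conj L
  let V := Submodule.span Qbar (Set.range I.coeff)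
  have hrank : Module.finrank Qbar V = 6 := by
    rw [finrank_span_eq_card I.indep, Fintype.card_fin]
  have hbad (x) (hx : x ∈ V) (hx0 : x ≠ 0) (w : AbsoluteValue L ℝ) (hw : AbsNontrivial w) :
      2 < (dominantBlocks Sigma.fst (fun i ↦ w (μ i)) x).card ∧
      (¬ IsNonarch w → 3 < (dominantBlocks Sigma.fst (fun i ↦ w (μ i)) x).card) := by
    obtain ⟨β, rfl⟩ := (Submodule.mem_span_range_iff_exists_fun Qbar).1 hx
    set y := ∑ p, β p • I.coeff p with hy
    have hβ : β ≠ 0 := by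
      rintro rfl
      simp [hy] at hx0
    have hex (i : Fin I.s) :
        (∃ t : (i : Fin I.s) × Fin (I.m i), t.1 = i ∧ y t ≠ 0) ↔ ∃ j, y ⟨i, j⟩ ≠ 0 :=
      ⟨by rintro ⟨⟨i, j⟩, rfl, h⟩; exact ⟨j, h⟩, fun ⟨j, h⟩ ↦ ⟨⟨i, j⟩, rfl, h⟩⟩
    have hdom : dominantBlocks Sigma.fst (fun i ↦ w (μ i)) y =
        Finset.univ.filter (fun i : Fin I.s ↦ (∃ j, y ⟨i, j⟩ ≠ 0) ∧
          ∀ i' : Fin I.s, (∃ j', y ⟨i', j'⟩ ≠ 0) →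
            w ⟨I.lam i', hmem i'⟩ ≤ w ⟨I.lam i, hmem i⟩) := by
      ext i
      simp only [dominantBlocks, Finset.mem_filter, hex, μ]
    by_contra hcon
    refine hI ⟨β, hβ, hx0, L, hmem, hL, w, hw, fun hna ↦ ?_, fun ha ↦ ?_⟩
    · rw [← hdom]
      by_contra hlt
      exact hcon ⟨by omega, fun ha ↦ absurd hna ha⟩
    · rw [← hdom]
      by_contra hlt
      exact hcon ⟨by omega, fun _ ↦ by omega⟩
  have hnull : HasNullSets ((fun i ↦ v (μ i)) ∘ Sigma.fst) V := by
    refine hasNullSets_of_dominantBlocks Sigma.fst (fun i ↦ v (μ i))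
      {h | ∃ w : AbsoluteValue L ℝ, AbsNontrivial w ∧ h = fun i ↦ w (μ i)} ?_
      (fun x hx hx0 ↦ (hbad x hx hx0 v hv).2 hvna) ?_ ?_ ?_
    · rintro _ ⟨w, -, rfl⟩ i
      exact w.pos (hμ0 i)
    · rintro _ ⟨w, hw, rfl⟩ x hx hx0
      exact (hbad x hx hx0 w hw).1
    · rintro _ ⟨w, hw, rfl⟩
      refine ⟨_, ⟨w.comp (f := (c : L →+* L)) c.injective, ?_, rfl⟩, fun i j hij ↦ ?_⟩
      · obtain ⟨x, hx0, hx⟩ := hw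
        refine ⟨c.symm x, by simpa using hx0, ?_⟩
        change w (c (c.symm x)) ≠ 1
        rwa [c.apply_symm_apply]
      · change w (c (μ i)) * w (μ i) = w (c (μ j)) * w (μ j)
        rw [← map_mul, ← map_mul, hc _ _ hij]
    · intro i j hij
      obtain ⟨w, hw, hne⟩ := exists_absoluteValue_ne (hμ0 i) (hμ0 j) fun n hn h ↦
        I.nondeg i j hij n hn (by simpa [μ] using congrArg (Subtype.val (p := (· ∈ L))) h)
      exact ⟨_, ⟨w, hw, rfl⟩, hne⟩
  have hcard : (codeSupport V).card ≤ 12 :=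
    (Finset.card_le_univ _).trans (by simpa using I.order_le)
  exact (hnull.twelve_lt_card_codeSupport le_rfl hrank).not_ge hcard

end
end

section
/- For all integers d, k with 1 ≤ k ≤ d and d − k ≤ 2·log₃(d) (logarithm to base 3), every exponential-polynomial instance of order at most d with k sequences is MSTV-reducible. (This is the paper's main theorem: SimSkolem(d,k) is decidable whenever d − k ≤ 2 log₃ d, equivalently the reduced Subspace Orbit Problem Orbit(d,t) is decidable whenever t ≤ 2 log₃ d.) -/
open scoped Classical

noncomputable section

section Linear

variable {K T : Type*} [Field K]

/-- The vectors supported in the finite set `S` of coordinates. -/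
def supportedIn (K : Type*) {T : Type*} [Field K] (S : Finset T) : Submodule K (T → K) :=
  Submodule.pi ({x | x ∉ S}) (fun _ => (⊥ : Submodule K K))

theorem mem_supportedIn {S : Finset T} {w : T → K} :
    w ∈ supportedIn K S ↔ ∀ x, x ∉ S → w x = 0 :=
  Iff.rfl

variable [Fintype T]

theorem finrank_inf_supportedIn_le (W : Submodule K (T → K)) (S S' : Finset T) :
    Module.finrank K ↥(W ⊓ supportedIn K S) ≤
      Module.finrank K ↥(W ⊓ supportedIn K S') + (S \ S').card := by
  let f : ↥(W ⊓ supportedIn K S) →ₗ[K] (↥(S \ S') → K) :=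
    { toFun := fun w x => w.1 x.1
      map_add' := fun _ _ => rfl
      map_smul' := fun _ _ => rfl }
  have h := f.finrank_range_add_finrank_ker
  have hr : Module.finrank K (LinearMap.range f) ≤ (S \ S').card := by
    refine (Submodule.finrank_le _).trans ?_
    rw [Module.finrank_pi, Fintype.card_coe]
  have hker : Module.finrank K (LinearMap.ker f) ≤ Module.finrank K ↥(W ⊓ supportedIn K S') := by
    let g : LinearMap.ker f →ₗ[K] ↥(W ⊓ supportedIn K S') :=
      { toFun := fun w => ⟨w.1.1, w.1.2.1, mem_supportedIn.2 fun x hx => by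
          by_cases hxS : x ∈ S
          · exact congrFun (LinearMap.mem_ker.1 w.2) ⟨x, Finset.mem_sdiff.2 ⟨hxS, hx⟩⟩
          · exact mem_supportedIn.1 w.1.2.2 x hxS⟩
        map_add' := fun _ _ => rfl
        map_smul' := fun _ _ => rfl }
    refine LinearMap.finrank_le_finrank_of_injective (f := g) fun a b hab => ?_
    exact Subtype.ext (Subtype.ext (congrArg (fun z => z.1) hab))
  omega

theorem exists_mem_supportedIn_ne_zero {W : Submodule K (T → K)} {S S' : Finset T} {t : ℕ}
    (hS : S.card ≤ Module.finrank K ↥(W ⊓ supportedIn K S) + t) (hsub : S' ⊆ S)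
    (hcard : t < S'.card) : ∃ w ∈ W ⊓ supportedIn K S', w ≠ 0 := by
  have h := finrank_inf_supportedIn_le W S S'
  have hc := Finset.card_sdiff_add_card_eq_card hsub
  refine Submodule.exists_mem_ne_zero_of_ne_bot fun hbot => ?_
  rw [hbot, finrank_bot] at h
  omega

/-- Some nonzero vector of `W` has, for some nontrivial absolute value, at most two dominant
values of `r` on its support. -/
def HasFewDominant {L : Type*} [Field L] (W : Submodule K (T → K)) (r : T → L) : Prop :=
  ∃ w ∈ W, w ≠ 0 ∧ ∃ v : AbsoluteValue L ℝ, AbsNontrivial v ∧ ∃ P : Finset L, P.card ≤ 2 ∧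
    ∀ x, w x ≠ 0 → (∀ y, w y ≠ 0 → v (r y) ≤ v (r x)) → r x ∈ P

theorem hasFewDominant_of_card_image_le {L : Type*} [Field L] {W : Submodule K (T → K)}
    {r : T → L} {S S' : Finset T} {t : ℕ} {v : AbsoluteValue L ℝ} (hv : AbsNontrivial v)
    (hS : S.card ≤ Module.finrank K ↥(W ⊓ supportedIn K S) + t) (hsub : S' ⊆ S)
    (hcard : t < S'.card) (hr : (S'.image r).card ≤ 2) : HasFewDominant W r := by
  obtain ⟨w, ⟨hw, hwS⟩, hw0⟩ := exists_mem_supportedIn_ne_zero hS hsub hcard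
  refine ⟨w, hw, hw0, v, hv, S'.image r, hr, fun x hx _ => Finset.mem_image_of_mem r ?_⟩
  exact by_contra fun h => hx (mem_supportedIn.1 hwS x h)

/-- Either `W` contains a vector with few dominant values for `v`, or restricting to the
non-dominant coordinates lowers the codimension. -/
theorem hasFewDominant_or_codim_le {L : Type*} [Field L] {W : Submodule K (T → K)}
    {r : T → L} {S : Finset T} {t : ℕ} {v : AbsoluteValue L ℝ} (hv : AbsNontrivial v) {x : T}
    (hmax : ∀ y ∈ S, v (r y) ≤ v (r x))
    (hS : S.card ≤ Module.finrank K ↥(W ⊓ supportedIn K S) + t) :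
    HasFewDominant W r ∨
      (S.filter fun y => v (r y) ≠ v (r x)).card
          + min 2 (S.filter fun y => v (r y) = v (r x)).card ≤
        Module.finrank K ↥(W ⊓ supportedIn K (S.filter fun y => v (r y) ≠ v (r x))) + t := by
  set A := S.filter fun y => v (r y) = v (r x) with hA
  set B := S.filter fun y => v (r y) ≠ v (r x) with hB
  have hAB : A.card + B.card = S.card := Finset.card_filter_add_card_filter_not _
  obtain ⟨P, hPA, hPc⟩ := Finset.exists_subset_card_eq (min_le_right 2 A.card)
  have hsub : A \ P ⊆ S := Finset.sdiff_subset.trans (Finset.filter_subset _ _)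
  have hrank := finrank_inf_supportedIn_le W S (S \ (A \ P))
  rw [Finset.sdiff_sdiff_eq_self hsub] at hrank
  have hcP := Finset.card_sdiff_add_card_eq_card hPA
  by_cases hle : W ⊓ supportedIn K (S \ (A \ P)) ≤ W ⊓ supportedIn K B
  · right
    have := Submodule.finrank_mono hle
    omega
  left
  obtain ⟨w, ⟨hw, hwS⟩, hwB⟩ := SetLike.not_le_iff_exists.1 hle
  have hmem : ∀ y, w y ≠ 0 → y ∈ S ∧ (v (r y) = v (r x) → y ∈ P) := fun y hy => by
    have : y ∈ S \ (A \ P) := by_contra fun h => hy (mem_supportedIn.1 hwS y h)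
    simp only [Finset.mem_sdiff, hA, Finset.mem_filter] at this
    tauto
  have hex : ∃ z, w z ≠ 0 ∧ v (r z) = v (r x) := by
    by_contra! hcon
    refine hwB ⟨hw, mem_supportedIn.2 fun y hy => by_contra fun hy0 => hy ?_⟩
    exact Finset.mem_filter.2 ⟨(hmem y hy0).1, hcon y hy0⟩
  obtain ⟨z, hz, hzx⟩ := hex
  refine ⟨w, hw, fun h => hz (by simp [h]), v, hv, P.image r,
    Finset.card_image_le.trans (by omega), fun y hy hdom => Finset.mem_image_of_mem r ?_⟩
  exact (hmem y hy).2 (le_antisymm (hmax y (hmem y hy).1) (hzx ▸ hdom z hz))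

end Linear

section Places

variable {L : Type*} [Field L] [NumberField L]

theorem abs_nontrivial_place (φ : L →+* ℂ) : AbsNontrivial (NumberField.place φ) :=
  ⟨2, two_ne_zero, by rw [NumberField.place_apply, map_ofNat]; norm_num⟩

/-- Kronecker's theorem: an element that is not a root of unity has absolute value different
from `1` for some absolute value. -/
theorem exists_absoluteValue_ne_one {x : L} (hx : ∀ n : ℕ, 1 ≤ n → x ^ n ≠ 1) :
    ∃ v : AbsoluteValue L ℝ, v x ≠ 1 := by
  by_contra! h
  have hint : IsIntegral ℤ x := by
    have := IsDedekindDomain.HeightOneSpectrum.mem_integers_of_valuation_le_one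
      (R := NumberField.RingOfIntegers L) L x fun P => ?_
    · obtain ⟨y, rfl⟩ := this
      exact NumberField.RingOfIntegers.isIntegral_coe y
    · have hP := h (NumberField.HeightOneSpectrum.adicAbv L P)
      rw [NumberField.HeightOneSpectrum.adicAbv_def] at hP
      have h1 : WithZeroMulInt.toNNReal (NumberField.HeightOneSpectrum.absNorm_ne_zero P) (P.valuation L x) ≤ 1 := by
        exact_mod_cast hP.le
      exact (WithZeroMulInt.toNNReal_le_one_iff (NumberField.HeightOneSpectrum.one_lt_absNorm_nnreal P)).1 h1
  obtain ⟨n, hn, hxn⟩ := NumberField.Embeddings.pow_eq_one_of_norm_eq_one L ℂ hint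
    fun φ => by simpa using h (NumberField.place φ)
  exact hx n hn hxn

/-- Composing `v` with the complex conjugation attached to `φ` reverses the order given by `v` on
nonzero elements of the same modulus under `φ`. -/
theorem exists_opposite_absoluteValue [IsGalois ℚ L] (φ : L →+* ℂ) (v : AbsoluteValue L ℝ) :
    ∃ v' : AbsoluteValue L ℝ, ∀ x y : L, ‖φ x‖ = ‖φ y‖ → v x * v' x = v y * v' y := by
  obtain ⟨σ, hσ⟩ := NumberField.ComplexEmbedding.exists_comp_symm_eq_of_comp_eq (k := ℚ) φ
    ((starRingEnd ℂ).comp φ) (by ext; simp)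
  refine ⟨v.comp (f := (σ.symm : L →+* L)) σ.symm.injective, fun x y hxy => ?_⟩
  have hc : ∀ z, φ (σ.symm z) = starRingEnd ℂ (φ z) := fun z => RingHom.congr_fun hσ z
  have : x * σ.symm x = y * σ.symm y := by
    apply φ.injective
    rw [map_mul, map_mul, hc, hc, Complex.mul_conj, Complex.mul_conj, Complex.normSq_eq_norm_sq,
      Complex.normSq_eq_norm_sq, hxy]
  have h2 := congrArg v this
  rwa [map_mul, map_mul] at h2

end Places
section Arithmetic

theorem nine_mul_sq_le_four_mul_three_pow {t : ℕ} (ht : 2 ≤ t) : 9 * t ^ 2 ≤ 4 * 3 ^ t := by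
  induction t, ht using Nat.le_induction with
  | base => norm_num
  | succ t ht ih => rw [pow_succ 3 t]; nlinarith

theorem three_pow_le_three_mul_pred_sq {t a s : ℕ} (ht : 2 ≤ t) (hs : 3 ^ t ≤ s ^ 2)
    (ha : 2 * s < 3 * a) : 3 ^ t ≤ 3 * (a - 1) ^ 2 := by
  obtain ⟨b, rfl⟩ : ∃ b, a = b + 1 := ⟨a - 1, by omega⟩
  rw [Nat.add_sub_cancel]
  by_cases h8 : 8 ≤ s
  · nlinarith
  obtain ht4 | ht4 := le_or_gt 4 t
  · have : 3 ^ 4 ≤ 3 ^ t := Nat.pow_le_pow_right (by norm_num) ht4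
    nlinarith
  interval_cases t
  · have : 3 ≤ s := by nlinarith
    have : 2 ≤ b := by omega
    nlinarith
  · have : 6 ≤ s := by nlinarith
    have : 4 ≤ b := by omega
    nlinarith

/-- The inequality `3 ^ (d - k) ≤ d ^ 2` is inherited when `d` decreases towards `k`. -/
theorem three_pow_sub_le_sq {k D : ℕ} (hk : 1 ≤ k) (hkD : k ≤ D) (e : ℕ)
    (h : 3 ^ (D + e - k) ≤ (D + e) ^ 2) : 3 ^ (D - k) ≤ D ^ 2 := by
  induction e with
  | zero => exact h
  | succ e ih =>
    obtain hD | hD := Nat.lt_or_ge (D + e) 2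
    · obtain rfl : D = k := by omega
      simp only [Nat.sub_self, pow_zero]
      nlinarith
    · refine ih ?_
      rw [show D + (e + 1) - k = (D + e - k) + 1 by omega, pow_succ, ← add_assoc] at h
      nlinarith

end Arithmetic

/-- A subspace of codimension `t` in at least `3 ^ (t / 2)` coordinates, with nondegenerate roots,
contains a vector with few dominant roots. By induction one may assume that most roots have the same
modulus under `φ`; then the dominant sets of two opposite absolute values are disjoint, so one of
them is small. -/
theorem hasFewDominant_of_three_pow_le {K T L : Type*} [Field K] [Fintype T] [Field L]
    [NumberField L] [IsGalois ℚ L] (W : Submodule K (T → K)) (r : T → L)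
    (hr : ∀ x y, r x ≠ r y → ∀ n : ℕ, 1 ≤ n → (r x / r y) ^ n ≠ 1) (hr0 : ∀ x, r x ≠ 0)
    (t : ℕ) (S : Finset T) (hS : S.card ≤ Module.finrank K ↥(W ⊓ supportedIn K S) + t)
    (hcard : 3 ^ t ≤ S.card ^ 2) : HasFewDominant W r := by
  obtain ⟨φ⟩ : Nonempty (L →+* ℂ) := inferInstance
  induction t using Nat.strong_induction_on generalizing S with
  | _ t ih =>
  obtain ht | ht := Nat.lt_or_ge t 2
  · have htS : t < S.card := by
      interval_cases t <;> nlinarith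
    obtain ⟨S', hS', hc⟩ := Finset.exists_subset_card_eq (Nat.succ_le_of_lt htS)
    exact hasFewDominant_of_card_image_le (abs_nontrivial_place φ) hS hS' (by omega)
      (Finset.card_image_le.trans (by omega))
  have h9 : 3 ^ t = 9 * 3 ^ (t - 2) := by
    rw [show (9 : ℕ) = 3 ^ 2 by norm_num, ← pow_add]; congr 1; omega
  have h3 : 3 ^ t = 3 * 3 ^ (t - 1) := by
    rw [← pow_succ']; congr 1; omega
  have hpos : 0 < 3 ^ (t - 2) := by positivity
  have hS3 : 3 ≤ S.card := by nlinarith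
  have step : ∀ (S₁ : Finset T) (v : AbsoluteValue L ℝ) (x : T), AbsNontrivial v → x ∈ S₁ →
      (∀ y ∈ S₁, v (r y) ≤ v (r x)) →
      S₁.card ≤ Module.finrank K ↥(W ⊓ supportedIn K S₁) + t →
      S.card ≤ 3 * (S₁.filter fun y => v (r y) ≠ v (r x)).card →
      3 ^ t ≤ 3 * (S₁.card - 1) ^ 2 → HasFewDominant W r := by
    intro S₁ v x hv hx hmax hS₁ hB hS₁c
    obtain h | h := hasFewDominant_or_codim_le hv hmax hS₁
    · exact h
    have hsum : (S₁.filter fun y => v (r y) = v (r x)).card +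
      (S₁.filter fun y => v (r y) ≠ v (r x)).card = S₁.card :=
      Finset.card_filter_add_card_filter_not _
    have hA : 0 < (S₁.filter fun y => v (r y) = v (r x)).card :=
      Finset.card_pos.2 ⟨x, Finset.mem_filter.2 ⟨hx, rfl⟩⟩
    obtain hA2 | hA2 := Nat.lt_or_ge (S₁.filter fun y => v (r y) = v (r x)).card 2
    · refine ih (t - 1) (by omega) (S₁.filter fun y => v (r y) ≠ v (r x)) (by omega) ?_
      rw [show (S₁.filter fun y => v (r y) ≠ v (r x)).card = S₁.card - 1 by omega]
      omega
    · exact ih (t - 2) (by omega) (S₁.filter fun y => v (r y) ≠ v (r x)) (by omega) (by nlinarith)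
  obtain ⟨x₀, hx₀, hmax₀⟩ := S.exists_max_image (fun x => NumberField.place φ (r x))
    (Finset.card_pos.1 (by omega))
  obtain hB | hB := le_or_gt S.card
    (3 * (S.filter fun y => NumberField.place φ (r y) ≠ NumberField.place φ (r x₀)).card)
  · exact step S _ x₀ (abs_nontrivial_place φ) hx₀ hmax₀ hS hB
      (three_pow_le_three_mul_pred_sq ht hcard (by omega))
  have hsum : _ + (S.filter fun y => NumberField.place φ (r y) ≠ NumberField.place φ (r x₀)).card
    = _ := S.card_filter_add_card_filter_not
      fun y => NumberField.place φ (r y) = NumberField.place φ (r x₀)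
  set A := S.filter fun y => NumberField.place φ (r y) = NumberField.place φ (r x₀) with hA
  have hAS : A ⊆ S := Finset.filter_subset _ _
  have hAc : 2 * S.card < 3 * A.card := by omega
  have hAφ : ∀ x ∈ A, ∀ y ∈ A, ‖φ (r x)‖ = ‖φ (r y)‖ := fun x hx y hy =>
    (Finset.mem_filter.1 hx).2.trans (Finset.mem_filter.1 hy).2.symm
  have hSA : A.card ≤ Module.finrank K ↥(W ⊓ supportedIn K A) + t := by
    have := finrank_inf_supportedIn_le W S A
    have := Finset.card_sdiff_add_card_eq_card hAS
    omega
  by_cases hone : (A.image r).card ≤ 2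
  · have := nine_mul_sq_le_four_mul_three_pow ht
    exact hasFewDominant_of_card_image_le (abs_nontrivial_place φ) hSA subset_rfl
      (by nlinarith) hone
  obtain ⟨p', hp', q', hq', hpq⟩ := Finset.one_lt_card.1 (show 1 < (A.image r).card by omega)
  obtain ⟨p, hp, rfl⟩ := Finset.mem_image.1 hp'
  obtain ⟨q, hq, rfl⟩ := Finset.mem_image.1 hq'
  obtain ⟨v, hv⟩ := exists_absoluteValue_ne_one (hr p q hpq)
  rw [map_div₀, Ne, div_eq_one_iff_eq (v.ne_zero (hr0 q))] at hv
  obtain ⟨v', hv'⟩ := exists_opposite_absoluteValue φ v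
  have hmul := hv' (r p) (r q) (hAφ p hp q hq)
  have hpos : ∀ (u : AbsoluteValue L ℝ) x, 0 < u (r x) := fun u x => u.pos (hr0 x)
  have hvp' : v' (r p) ≠ v' (r q) := fun h => hv (by
    rw [h] at hmul; exact mul_right_cancel₀ (hpos v' q).ne' hmul)
  have hnontriv : ∀ u : AbsoluteValue L ℝ, u (r p) ≠ u (r q) → AbsNontrivial u := fun u hu =>
    ⟨r p / r q, div_ne_zero (hr0 p) (hr0 q), by
      rwa [map_div₀, Ne, div_eq_one_iff_eq (u.ne_zero (hr0 q))]⟩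
  obtain ⟨x, hx, hmax⟩ := A.exists_max_image (fun x => v (r x)) ⟨p, hp⟩
  obtain ⟨x', hx', hmax'⟩ := A.exists_max_image (fun x => v' (r x)) ⟨p, hp⟩
  have hdisj : Disjoint (A.filter fun y => v (r y) = v (r x))
      (A.filter fun y => v' (r y) = v' (r x')) := by
    refine Finset.disjoint_left.2 fun y hy hy' => hv ?_
    rw [Finset.mem_filter] at hy hy'
    have key : ∀ z ∈ A, v (r z) = v (r y) := fun z hz => by
      have h1 : v (r z) ≤ v (r y) := (hmax z hz).trans hy.2.ge
      have h2 : v' (r z) ≤ v' (r y) := (hmax' z hz).trans hy'.2.ge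
      have h3 := hv' (r z) (r y) (hAφ z hz y hy.1)
      nlinarith [hpos v z, hpos v y, hpos v' z, hpos v' y]
    rw [key p hp, key q hq]
  have hunion := Finset.card_le_card (Finset.union_subset
    (A.filter_subset fun y => v (r y) = v (r x)) (A.filter_subset fun y => v' (r y) = v' (r x')))
  rw [Finset.card_union_of_disjoint hdisj] at hunion
  have hs := A.card_filter_add_card_filter_not fun y => v (r y) = v (r x)
  have hs' := A.card_filter_add_card_filter_not fun y => v' (r y) = v' (r x')
  have hAt := three_pow_le_three_mul_pred_sq ht hcard hAc
  obtain hle | hle := le_total (A.filter fun y => v (r y) = v (r x)).card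
    (A.filter fun y => v' (r y) = v' (r x')).card
  · exact step A v x (hnontriv v hv) hx hmax hSA (by simp only [ne_eq]; omega) hAt
  · exact step A v' x' (hnontriv v' hvp') hx' hmax' hSA (by simp only [ne_eq]; omega) hAt

instance isAlgebraic_qbar : Algebra.IsAlgebraic ℚ Qbar := by
  have h : ∀ A : Algebra ℚ Qbar, @Algebra.IsAlgebraic ℚ Qbar _ _ A := fun A => by
    rw [Subsingleton.elim A (AlgebraicClosure.instAlgebra ℚ)]
    exact AlgebraicClosure.isAlgebraic ℚ
  exact h _

/-- Finitely many algebraic numbers lie in a common Galois number field. -/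
theorem exists_galois_numberField {s : ℕ} (lam : Fin s → Qbar) :
    ∃ L : IntermediateField ℚ Qbar, (∀ i, lam i ∈ L) ∧ FiniteDimensional ℚ L ∧ IsGalois ℚ L := by
  have : FiniteDimensional ℚ (IntermediateField.adjoin ℚ (Set.range lam)) :=
    IntermediateField.finiteDimensional_adjoin fun x _ =>
      (Algebra.IsAlgebraic.isAlgebraic x).isIntegral
  have : IsAlgClosure ℚ Qbar := ⟨inferInstance, inferInstance⟩
  refine ⟨IntermediateField.normalClosure ℚ (IntermediateField.adjoin ℚ (Set.range lam)) Qbar,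
    fun i => ?_, inferInstance, IsGalois.normalClosure _ _ _⟩
  exact IntermediateField.le_normalClosure _ (IntermediateField.subset_adjoin _ _ ⟨i, rfl⟩)

/-- main theorem.  For `1 ≤ k ≤ d` with `d - k ≤ 2 log₃ d`, every
exponential-polynomial instance of order at most `d` with `k` sequences is MSTV-reducible. -/
theorem mstv_reducible_of_log (d k : ℕ) (hk : 1 ≤ k) (hkd : k ≤ d)
    (hlog : (d : ℝ) - (k : ℝ) ≤ 2 * Real.logb 3 (d : ℝ)) :
    ∀ I : ExpPolyInstance d k, MSTVReducible I := by
  intro I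
  obtain ⟨L, hmem, hfin, hgal⟩ := exists_galois_numberField I.lam
  have : NumberField L := ⟨⟩
  have hpow : 3 ^ (d - k) ≤ d ^ 2 := by
    have hd : (0 : ℝ) < d := by exact_mod_cast hk.trans hkd
    have h : (3 : ℝ) ^ ((d : ℝ) - k) ≤ 3 ^ (Real.logb 3 d * 2) :=
      Real.rpow_le_rpow_of_exponent_le (by norm_num) (by linarith)
    rw [Real.rpow_mul (by norm_num), Real.rpow_logb (by norm_num) (by norm_num) hd,
      ← Nat.cast_sub hkd, Real.rpow_natCast] at h
    exact_mod_cast h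
  set W := Submodule.span Qbar (Set.range I.coeff) with hW
  have hWk : Module.finrank Qbar W = k := by
    rw [hW, finrank_span_eq_card I.indep, Fintype.card_fin]
  have hT : Fintype.card ((i : Fin I.s) × Fin (I.m i)) = ∑ i, I.m i := by simp
  have hkT : k ≤ ∑ i, I.m i := by
    have := Submodule.finrank_le W
    rwa [hWk, Module.finrank_pi, hT] at this
  obtain ⟨e, he⟩ := Nat.exists_eq_add_of_le I.order_le
  have hpow' := three_pow_sub_le_sq hk hkT e (he ▸ hpow)
  have huniv : W ⊓ supportedIn Qbar Finset.univ = W :=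
    inf_eq_left.2 fun w _ => mem_supportedIn.2 fun x hx => absurd (Finset.mem_univ x) hx
  have hinj : Function.Injective fun i => (⟨I.lam i, hmem i⟩ : L) := fun i j h =>
    I.lam_injective (congrArg Subtype.val h)
  obtain ⟨w, hw, hw0, v, hv, P, hP, hdom⟩ := hasFewDominant_of_three_pow_le W
    (fun x => (⟨I.lam x.1, hmem x.1⟩ : L))
    (fun x y hxy n hn h => I.nondeg x.1 y.1 (fun h' => hxy (by simp only [h'])) n hn
      (by simpa using congrArg Subtype.val h))
    (fun x h => I.lam_ne_zero x.1 (congrArg Subtype.val h))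
    (∑ i, I.m i - k) Finset.univ (by rw [huniv, hWk, Finset.card_univ, hT]; omega)
    (by rwa [Finset.card_univ, hT])
  obtain ⟨β, rfl⟩ := (Submodule.mem_span_range_iff_exists_fun Qbar).1 hw
  have hcard : (Finset.univ.filter (fun i : Fin I.s =>
      (∃ j, (∑ p, β p • I.coeff p) ⟨i, j⟩ ≠ 0) ∧
      ∀ i' : Fin I.s, (∃ j', (∑ p, β p • I.coeff p) ⟨i', j'⟩ ≠ 0) →
        v ⟨I.lam i', hmem i'⟩ ≤ v ⟨I.lam i, hmem i⟩)).card ≤ 2 := by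
    refine (Finset.card_le_card_of_injOn (fun i => (⟨I.lam i, hmem i⟩ : L)) (fun i hi => ?_)
      hinj.injOn).trans hP
    obtain ⟨⟨j, hj⟩, hi⟩ := (Finset.mem_filter.1 hi).2
    exact hdom ⟨i, j⟩ hj fun y hy => hi y.1 ⟨y.2, hy⟩
  exact ⟨β, fun h => hw0 (by simp [h]), hw0, L, hmem, hfin, v, hv, fun _ => hcard,
    fun _ => hcard.trans (by norm_num)⟩

end
end

section
/- Fix an exponential-polynomial instance with index set T and roots λ₁,…,λ_s, and let C ⊆ ℚ̄^T be the ℚ̄-span of the coefficient vectors c⁽¹⁾,…,c⁽ᵏ⁾. Suppose u ∈ C is nonzero, lies in the MSTV class, and has minimal support among such vectors: there is no nonzero u' ∈ C lying in the MSTV class with supp(u') strictly contained in supp(u). Then every w ∈ C with supp(w) ⊆ supp(u) is a scalar multiple of u, i.e. w = η·u for some η ∈ ℚ̄; equivalently, the kernel of the projection of C onto the coordinates outside supp(u) is one-dimensional. -/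
open scoped Classical

noncomputable section

/-- If `f` attains its maximum over `P` at a point of `Q ⊆ P`, then `f` has at most as many
maximizers over `Q` as over `P`. -/
lemma card_maximizers_le_of_imp {ι : Type*} [Fintype ι] (f : ι → ℝ) {P Q : ι → Prop}
    [DecidablePred fun i => Q i ∧ ∀ i', Q i' → f i' ≤ f i]
    [DecidablePred fun i => P i ∧ ∀ i', P i' → f i' ≤ f i]
    (hQP : ∀ i, Q i → P i) {i₀ : ι} (hi₀ : Q i₀) (hmax : ∀ i, P i → f i ≤ f i₀) :
    (Finset.univ.filter (fun i => Q i ∧ ∀ i', Q i' → f i' ≤ f i)).card ≤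
      (Finset.univ.filter (fun i => P i ∧ ∀ i', P i' → f i' ≤ f i)).card := by
  refine Finset.card_le_card (Finset.monotone_filter_right _ ?_)
  exact fun i _ hi => ⟨hQP i hi.1, fun i' hi' => (hmax i' hi').trans (hi.2 i₀ hi₀)⟩

/-- A vector of the MSTV class has a coordinate in its support such that every vector supported
inside it and nonzero at that coordinate is again in the MSTV class. -/
lemma InMSTV.exists_coord {s : ℕ} {m : Fin s → ℕ} {lam : Fin s → Qbar}
    {u : ((i : Fin s) × Fin (m i)) → Qbar} (hu : InMSTV lam u) :
    ∃ σ, u σ ≠ 0 ∧ ∀ u' : ((i : Fin s) × Fin (m i)) → Qbar,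
      (∀ τ, u' τ ≠ 0 → u τ ≠ 0) → u' σ ≠ 0 → InMSTV lam u' := by
  obtain ⟨hu0, L, hmem, hL, v, hv, hna, ha⟩ := hu
  obtain ⟨τ₀, hτ₀⟩ := Function.ne_iff.mp hu0
  obtain ⟨σ, hσ, hmax⟩ := Set.exists_max_image {τ | u τ ≠ 0}
    (fun τ => v ⟨lam τ.1, hmem τ.1⟩) (Set.toFinite _) ⟨τ₀, hτ₀⟩
  refine ⟨σ, hσ, fun u' hsub hu'σ =>
    ⟨fun h => hu'σ (congrFun h σ), L, hmem, hL, v, hv, ?_⟩⟩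
  constructor <;> intro h
  on_goal 1 => refine le_trans ?_ (hna h)
  on_goal 2 => refine le_trans ?_ (ha h)
  all_goals
    exact card_maximizers_le_of_imp (fun i => v ⟨lam i, hmem i⟩)
      (P := fun i => ∃ j, u ⟨i, j⟩ ≠ 0) (Q := fun i => ∃ j, u' ⟨i, j⟩ ≠ 0)
      (fun i ⟨j, hj⟩ => ⟨j, hsub _ hj⟩) (i₀ := σ.1) ⟨σ.2, hu'σ⟩
      (fun i ⟨j, hj⟩ => hmax ⟨i, j⟩ hj)

/-- If `u` is a nonzero element of the span `C` of the coefficient vectors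
lying in the MSTV class, of minimal support among such vectors, then every `w ∈ C` whose
support is contained in that of `u` is a scalar multiple of `u`. -/
theorem mstv_minimal_support_kernel (d k : ℕ) (I : ExpPolyInstance d k)
    (u : ((i : Fin I.s) × Fin (I.m i)) → Qbar)
    (hu_mem : u ∈ Submodule.span Qbar (Set.range I.coeff))
    (hu : InMSTV I.lam u)
    (hmin : ∀ u' : ((i : Fin I.s) × Fin (I.m i)) → Qbar,
        u' ∈ Submodule.span Qbar (Set.range I.coeff) → InMSTV I.lam u' →
        ¬ ({τ | u' τ ≠ 0} ⊂ {τ | u τ ≠ 0})) :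
    ∀ w ∈ Submodule.span Qbar (Set.range I.coeff),
      {τ | w τ ≠ 0} ⊆ {τ | u τ ≠ 0} → ∃ η : Qbar, w = η • u := by
  intro w hw hwu
  obtain ⟨σ, hσ, hclass⟩ := hu.exists_coord
  refine ⟨w σ / u σ, ?_⟩
  by_contra hne
  set w' := w - (w σ / u σ) • u with hw'
  have hw'_mem : w' ∈ Submodule.span Qbar (Set.range I.coeff) :=
    sub_mem hw (Submodule.smul_mem _ _ hu_mem)
  have hw'σ : w' σ = 0 := by simp [hw', hσ]
  have hw'u : ∀ τ, u τ = 0 → w' τ = 0 := fun τ hτ => by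
    have hwτ : w τ = 0 := by_contra fun h => hwu h hτ
    simp [hw', hτ, hwτ]
  obtain ⟨τ, hτ : w' τ ≠ 0⟩ := Function.ne_iff.mp (sub_ne_zero.mpr hne : w' ≠ 0)
  set u' := u - (u τ / w' τ) • w' with hu'
  have hu'_mem : u' ∈ Submodule.span Qbar (Set.range I.coeff) :=
    sub_mem hu_mem (Submodule.smul_mem _ _ hw'_mem)
  have hsub : ∀ ρ, u' ρ ≠ 0 → u ρ ≠ 0 := fun ρ hρ h => hρ (by simp [hu', h, hw'u ρ h])
  have hu'τ : u' τ = 0 := by simp [hu', hτ]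
  have hu'σ : u' σ ≠ 0 := by simpa [hu', hw'σ] using hσ
  exact hmin u' hu'_mem (hclass u' hsub hu'σ)
    ⟨hsub, fun h => h (fun h0 => hτ (hw'u τ h0)) hu'τ⟩

end
end
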